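/- First order differential equations for the MOPUC of the generalized Jacobi weight w(θ) = e^{−ηθ}(sin²(θ/2))^λ (cos²(θ/2))^β: for every n ≥ 3, the following polynomial identities in z hold, with d = λ+β+iη: z(z²−1)Φ_n'(z) = {n z² − [ℓ_{n+1,n} + (d+n) conj(α_n) α_{n−1}] z − (conj(d)+n)} Φ_n(z) − [(d+n+1) conj(α_n) z + (conj(d)+n) conj(α_{n−1})] Φ_n*(z), and (1−z²)(Φ_n*)'(z) = [(d+n) α_{n−1} z + (conj(d)+n+1) α_n] Φ_n(z) + {d z + conj(ℓ_{n+1,n}) + (conj(d)+n) α_n conj(α_{n−1})} Φ_n*(z). -/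

import Mathlib

open Polynomial MeasureTheory

/-- The generalized Jacobi weight on the unit circle. -/
noncomputable def circleJacobiWeight (lam β η θ : ℝ) : ℝ :=
  Real.exp (-η * θ) * (Real.sin (θ / 2) ^ 2) ^ lam * (Real.cos (θ / 2) ^ 2) ^ β

theorem intervalIntegrable_sin_half_sq_rpow {lam : ℝ} (hlam : -1 / 2 < lam) :
    IntervalIntegrable (fun θ : ℝ => (Real.sin (θ / 2) ^ 2) ^ lam) volume 0 Real.pi := by
  have hpow : IntervalIntegrable (fun θ : ℝ => θ ^ (2 * lam)) volume 0 Real.pi :=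
    intervalIntegral.intervalIntegrable_rpow' (by linarith)
  have hcont : ContinuousOn (fun θ : ℝ => ((Real.sinc (θ / 2) / 2) ^ 2) ^ lam)
      (Set.uIcc 0 Real.pi) := by
    have hc : Continuous fun θ : ℝ => (Real.sinc (θ / 2) / 2) ^ 2 := by
      have := Real.continuous_sinc
      fun_prop
    refine hc.continuousOn.rpow_const fun θ hθ => Or.inl ?_
    rw [Set.uIcc_of_le Real.pi_pos.le] at hθ
    rcases eq_or_lt_of_le hθ.1 with h0 | h0
    · simp [← h0]
    · have hs : 0 < Real.sin (θ / 2) :=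
        Real.sin_pos_of_pos_of_lt_pi (by linarith) (by linarith [hθ.2])
      rw [Real.sinc_of_ne_zero (by positivity)]
      positivity
  refine (hpow.mul_continuousOn hcont).congr fun θ hθ => ?_
  rw [Set.uIoc_of_le Real.pi_pos.le] at hθ
  have h0 : 0 < θ := hθ.1
  have hsq : θ ^ (2 * lam) = (θ ^ 2) ^ lam := by
    rw [Real.rpow_mul h0.le]; norm_num
  change θ ^ (2 * lam) * _ = _
  rw [hsq, ← Real.mul_rpow (by positivity) (by positivity),
    Real.sinc_of_ne_zero (by positivity)]
  congr 1
  field_simp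

theorem intervalIntegrable_circleJacobiWeight {lam β : ℝ} (hlam : -1 / 2 < lam)
    (hβ : -1 / 2 < β) (η : ℝ) :
    IntervalIntegrable (circleJacobiWeight lam β η) volume 0 (2 * Real.pi) := by
  have hpi := Real.pi_pos
  have hexp : Continuous fun θ : ℝ => Real.exp (-η * θ) := by fun_prop
  have hsin : Continuous fun θ : ℝ => Real.sin (θ / 2) ^ 2 := by fun_prop
  have hcos : Continuous fun θ : ℝ => Real.cos (θ / 2) ^ 2 := by fun_prop
  have hA := intervalIntegrable_sin_half_sq_rpow hlam
  have hB := intervalIntegrable_sin_half_sq_rpow hβ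
  have near_sin : ∀ a b : ℝ,
      IntervalIntegrable (fun θ : ℝ => (Real.sin (θ / 2) ^ 2) ^ lam) volume a b →
      (∀ θ ∈ Set.uIcc a b, Real.cos (θ / 2) ≠ 0) →
      IntervalIntegrable (circleJacobiWeight lam β η) volume a b := fun a b h hne =>
    (h.continuousOn_mul hexp.continuousOn).mul_continuousOn
      (hcos.continuousOn.rpow_const fun θ hθ => Or.inl (pow_ne_zero 2 (hne θ hθ)))
  have near_cos : ∀ a b : ℝ,
      IntervalIntegrable (fun θ : ℝ => (Real.cos (θ / 2) ^ 2) ^ β) volume a b →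
      (∀ θ ∈ Set.uIcc a b, Real.sin (θ / 2) ≠ 0) →
      IntervalIntegrable (circleJacobiWeight lam β η) volume a b := fun a b h hne =>
    h.continuousOn_mul (hexp.continuousOn.mul
      (hsin.continuousOn.rpow_const fun θ hθ => Or.inl (pow_ne_zero 2 (hne θ hθ))))
  have h1 : IntervalIntegrable (circleJacobiWeight lam β η) volume 0 (Real.pi / 2) := by
    refine near_sin _ _ (hA.mono_set ?_) fun θ hθ => ?_
    · rw [Set.uIcc_of_le (by linarith), Set.uIcc_of_le (by linarith)]
      exact Set.Icc_subset_Icc le_rfl (by linarith)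
    · rw [Set.uIcc_of_le (by linarith)] at hθ
      exact (Real.cos_pos_of_mem_Ioo ⟨by linarith [hθ.1], by linarith [hθ.2]⟩).ne'
  have h2 : IntervalIntegrable (circleJacobiWeight lam β η) volume (Real.pi / 2) Real.pi := by
    refine near_cos _ _ ?_ fun θ hθ => ?_
    · have h := (hB.comp_sub_left Real.pi).symm
      rw [sub_self, sub_zero] at h
      refine (h.mono_set ?_).congr fun θ _ => ?_
      · rw [Set.uIcc_of_le (by linarith), Set.uIcc_of_le (by linarith)]
        exact Set.Icc_subset_Icc (by linarith) le_rfl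
      · rw [sub_div, Real.sin_pi_div_two_sub]
    · rw [Set.uIcc_of_le (by linarith)] at hθ
      exact (Real.sin_pos_of_pos_of_lt_pi (by linarith [hθ.1]) (by linarith [hθ.2])).ne'
  have h3 : IntervalIntegrable (circleJacobiWeight lam β η) volume Real.pi (3 * Real.pi / 2) := by
    refine near_cos _ _ ?_ fun θ hθ => ?_
    · have h := hB.comp_sub_right Real.pi
      refine (h.mono_set ?_).congr fun θ _ => ?_
      · rw [Set.uIcc_of_le (by linarith), Set.uIcc_of_le (by linarith)]
        exact Set.Icc_subset_Icc (by linarith) (by linarith)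
      · rw [sub_div, Real.sin_sub_pi_div_two, neg_sq]
    · rw [Set.uIcc_of_le (by linarith)] at hθ
      exact (Real.sin_pos_of_pos_of_lt_pi (by linarith [hθ.1]) (by linarith [hθ.2])).ne'
  have h4 : IntervalIntegrable (circleJacobiWeight lam β η) volume
      (3 * Real.pi / 2) (2 * Real.pi) := by
    refine near_sin _ _ ?_ fun θ hθ => ?_
    · have h := (hA.comp_sub_left (2 * Real.pi)).symm
      refine (h.mono_set ?_).congr fun θ _ => ?_
      · rw [Set.uIcc_of_le (by linarith), Set.uIcc_of_le (by linarith)]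
        exact Set.Icc_subset_Icc (by linarith) (by linarith)
      · rw [show (2 * Real.pi - θ) / 2 = Real.pi - θ / 2 by ring, Real.sin_pi_sub]
    · rw [Set.uIcc_of_le (by linarith)] at hθ
      exact (Real.cos_neg_of_pi_div_two_lt_of_lt (by linarith [hθ.1])
        (by linarith [hθ.2])).ne
  exact ((h1.trans h2).trans h3).trans h4

theorem circleJacobiWeight_nonneg (lam β η θ : ℝ) : 0 ≤ circleJacobiWeight lam β η θ := by
  unfold circleJacobiWeight
  positivity

theorem circleJacobiWeight_pos (lam β η : ℝ) {θ : ℝ} (hθ : θ ∈ Set.Ioo 0 Real.pi) :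
    0 < circleJacobiWeight lam β η θ := by
  have hs : 0 < Real.sin (θ / 2) :=
    Real.sin_pos_of_pos_of_lt_pi (by linarith [hθ.1]) (by linarith [hθ.1, hθ.2])
  have hc : 0 < Real.cos (θ / 2) :=
    Real.cos_pos_of_mem_Ioo ⟨by linarith [hθ.1, Real.pi_pos], by linarith [hθ.2]⟩
  unfold circleJacobiWeight
  positivity

theorem continuous_mul_sq_rpow {r : ℝ} (hr : -1 / 2 < r) :
    Continuous fun s : ℝ => s * (s ^ 2) ^ r := by
  rw [continuous_iff_continuousAt]
  intro s
  rcases eq_or_ne s 0 with rfl | hs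
  · have hlim : Filter.Tendsto (fun s : ℝ => (s ^ 2) ^ (r + 1 / 2)) (nhds 0) (nhds 0) := by
      have hc : Continuous fun s : ℝ => (s ^ 2) ^ (r + 1 / 2) :=
        (continuous_pow 2).rpow_const fun _ => Or.inr (by linarith)
      have h := hc.tendsto 0
      simp only [ne_eq, OfNat.ofNat_ne_zero, not_false_eq_true, zero_pow] at h
      rwa [Real.zero_rpow (by linarith)] at h
    have hbound : ∀ s : ℝ, ‖s * (s ^ 2) ^ r‖ ≤ (s ^ 2) ^ (r + 1 / 2) := by
      intro s
      rcases eq_or_ne s 0 with rfl | hs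
      · simp only [zero_mul, norm_zero]
        positivity
      · rw [Real.rpow_add (by positivity), ← Real.sqrt_eq_rpow, Real.sqrt_sq_eq_abs, norm_mul,
          Real.norm_eq_abs, Real.norm_eq_abs, abs_of_nonneg (by positivity : 0 ≤ (s ^ 2) ^ r),
          mul_comm]
    have h0 := squeeze_zero_norm hbound hlim
    simpa [ContinuousAt] using h0
  · exact continuousAt_id.mul
      ((continuous_pow 2).continuousAt.rpow_const (Or.inl (pow_ne_zero 2 hs)))

theorem continuous_sin_mul_circleJacobiWeight {lam β : ℝ} (hlam : -1 / 2 < lam)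
    (hβ : -1 / 2 < β) (η : ℝ) :
    Continuous fun θ : ℝ => Real.sin θ * circleJacobiWeight lam β η θ := by
  have h1 := (continuous_mul_sq_rpow hlam).comp
    (by fun_prop : Continuous fun θ : ℝ => Real.sin (θ / 2))
  have h2 := (continuous_mul_sq_rpow hβ).comp
    (by fun_prop : Continuous fun θ : ℝ => Real.cos (θ / 2))
  have h3 : Continuous fun θ : ℝ => 2 * Real.exp (-η * θ) := by fun_prop
  refine ((h3.mul h1).mul h2).congr fun θ => ?_
  have hs : Real.sin θ = 2 * Real.sin (θ / 2) * Real.cos (θ / 2) := by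
    rw [← Real.sin_two_mul]; congr 1; ring
  simp only [Pi.mul_apply, Function.comp_apply, circleJacobiWeight, hs]
  ring

theorem hasDerivAt_sin_mul_circleJacobiWeight (lam β η : ℝ) {θ : ℝ}
    (hs : Real.sin (θ / 2) ≠ 0) (hc : Real.cos (θ / 2) ≠ 0) :
    HasDerivAt (fun θ : ℝ => Real.sin θ * circleJacobiWeight lam β η θ)
      (((1 + lam + β) * Real.cos θ - η * Real.sin θ + (lam - β)) *
        circleJacobiWeight lam β η θ) θ := by
  have hhalf : HasDerivAt (fun θ : ℝ => θ / 2) (1 / 2) θ := (hasDerivAt_id θ).div_const 2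
  have hE : HasDerivAt (fun θ : ℝ => Real.exp (-η * θ)) (Real.exp (-η * θ) * (-η * 1)) θ :=
    ((hasDerivAt_id θ).const_mul (-η)).exp
  have hA := (hhalf.sin.pow 2).rpow_const (p := lam) (Or.inl (pow_ne_zero 2 hs))
  have hB := (hhalf.cos.pow 2).rpow_const (p := β) (Or.inl (pow_ne_zero 2 hc))
  refine ((Real.hasDerivAt_sin θ).mul ((hE.mul hA).mul hB)).congr_deriv ?_
  simp only [Pi.pow_apply, Pi.mul_apply]
  have hsin : Real.sin θ = 2 * Real.sin (θ / 2) * Real.cos (θ / 2) := by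
    rw [← Real.sin_two_mul]; congr 1; ring
  have hcos : Real.cos θ = Real.cos (θ / 2) ^ 2 - Real.sin (θ / 2) ^ 2 := by
    rw [← Real.cos_two_mul']; congr 1; ring
  have hone := Real.sin_sq_add_cos_sq (θ / 2)
  rw [Real.rpow_sub_one (pow_ne_zero 2 hs), Real.rpow_sub_one (pow_ne_zero 2 hc)]
  unfold circleJacobiWeight
  rw [hsin, hcos]
  have hsplit : lam - β = (lam - β) * (Real.sin (θ / 2) ^ 2 + Real.cos (θ / 2) ^ 2) := by
    rw [hone, mul_one]
  rw [hsplit]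
  field_simp
  ring

theorem intervalIntegrable_eval_circle {w : ℝ → ℝ}
    (hw : IntervalIntegrable w volume 0 (2 * Real.pi)) (p : ℂ[X]) (k : ℤ) :
    IntervalIntegrable (fun θ : ℝ => p.eval (Complex.exp ((θ : ℂ) * Complex.I)) *
      Complex.exp (-(k : ℂ) * (θ : ℂ) * Complex.I) * (w θ : ℂ)) volume 0 (2 * Real.pi) := by
  have hw' : IntervalIntegrable (fun θ => (w θ : ℂ)) volume 0 (2 * Real.pi) :=
    ⟨hw.1.ofReal, hw.2.ofReal⟩
  refine hw'.continuousOn_mul (Continuous.continuousOn ?_)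
  have := p.continuous
  fun_prop

/-- The functionals `p ↦ ∫ p(e^{iθ}) e^{-ikθ} w(θ) dθ` attached to a weight on the circle. -/
noncomputable def circlePairing (w : ℝ → ℝ) (hw : IntervalIntegrable w volume 0 (2 * Real.pi))
    (k : ℤ) : ℂ[X] →ₗ[ℂ] ℂ where
  toFun p := ∫ θ in (0 : ℝ)..(2 * Real.pi), p.eval (Complex.exp ((θ : ℂ) * Complex.I)) *
    Complex.exp (-(k : ℂ) * (θ : ℂ) * Complex.I) * (w θ : ℂ)
  map_add' p q := by
    rw [← intervalIntegral.integral_add (intervalIntegrable_eval_circle hw p k)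
      (intervalIntegrable_eval_circle hw q k)]
    congr 1 with θ
    rw [eval_add]
    ring
  map_smul' c p := by
    rw [RingHom.id_apply, smul_eq_mul, ← intervalIntegral.integral_const_mul]
    congr 1 with θ
    rw [eval_smul, smul_eq_mul]
    ring

section circlePairing

variable {w : ℝ → ℝ} (hw : IntervalIntegrable w volume 0 (2 * Real.pi))

theorem circlePairing_apply (k : ℤ) (p : ℂ[X]) :
    circlePairing w hw k p = ∫ θ in (0 : ℝ)..(2 * Real.pi),
      p.eval (Complex.exp ((θ : ℂ) * Complex.I)) *
        Complex.exp (-(k : ℂ) * (θ : ℂ) * Complex.I) * (w θ : ℂ) := rfl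

theorem circlePairing_X_mul (k : ℤ) (p : ℂ[X]) :
    circlePairing w hw k (X * p) = circlePairing w hw (k - 1) p := by
  rw [circlePairing_apply, circlePairing_apply]
  congr 1 with θ
  have h : Complex.exp (-((k - 1 : ℤ) : ℂ) * (θ : ℂ) * Complex.I) =
      Complex.exp ((θ : ℂ) * Complex.I) * Complex.exp (-(k : ℂ) * (θ : ℂ) * Complex.I) := by
    rw [← Complex.exp_add]
    congr 1
    push_cast
    ring
  rw [h, eval_mul, eval_X]
  ring

theorem conj_exp_mul_I (θ : ℝ) (k : ℂ) (hk : (starRingEnd ℂ) k = k) :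
    (starRingEnd ℂ) (Complex.exp (k * (θ : ℂ) * Complex.I)) =
      Complex.exp (-k * (θ : ℂ) * Complex.I) := by
  rw [← Complex.exp_conj, map_mul, map_mul, hk, Complex.conj_ofReal, Complex.conj_I]
  congr 1
  ring

theorem eval_map_conj (p : ℂ[X]) (z : ℂ) :
    (p.map (starRingEnd ℂ)).eval ((starRingEnd ℂ) z) = (starRingEnd ℂ) (p.eval z) := by
  rw [eval_map, eval₂_hom]

theorem eval_reflect_map_conj {n : ℕ} {p : ℂ[X]} (hp : p.natDegree ≤ n) (θ : ℝ) :
    (reflect n (p.map (starRingEnd ℂ))).eval (Complex.exp ((θ : ℂ) * Complex.I)) =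
      Complex.exp ((n : ℂ) * (θ : ℂ) * Complex.I) *
        (starRingEnd ℂ) (p.eval (Complex.exp ((θ : ℂ) * Complex.I))) := by
  set z := Complex.exp ((θ : ℂ) * Complex.I) with hz
  have hconj : (starRingEnd ℂ) z = z⁻¹ := by
    have h := conj_exp_mul_I θ 1 (map_one _)
    rw [one_mul] at h
    rw [hz, h, ← Complex.exp_neg]
    congr 1
    ring
  have hz0 : z ≠ 0 := Complex.exp_ne_zero _
  have hpow : Complex.exp ((n : ℂ) * (θ : ℂ) * Complex.I) = z ^ n := by
    rw [hz, ← Complex.exp_nat_mul]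
    congr 1
    ring
  rw [hpow, ← eval_map_conj, hconj]
  let _ : Invertible z⁻¹ := invertibleOfNonzero (inv_ne_zero hz0)
  have hdeg : (p.map (starRingEnd ℂ)).natDegree ≤ n := natDegree_map_le.trans hp
  have h := eval₂_reflect_mul_pow (RingHom.id ℂ) (z⁻¹) n (p.map (starRingEnd ℂ)) hdeg
  rw [invOf_eq_inv, inv_inv] at h
  change eval z _ * _ = eval _ _ at h
  rw [← h, inv_pow]
  field_simp

theorem circlePairing_reflect (k : ℤ) {n : ℕ} {p : ℂ[X]} (hp : p.natDegree ≤ n) :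
    circlePairing w hw k (reflect n (p.map (starRingEnd ℂ))) =
      (starRingEnd ℂ) (circlePairing w hw (n - k) p) := by
  rw [circlePairing_apply, circlePairing_apply, ← intervalIntegral.intervalIntegral_conj]
  congr 1 with θ
  rw [eval_reflect_map_conj hp, map_mul, map_mul, Complex.conj_ofReal,
    conj_exp_mul_I θ _ (by simp)]
  have h : Complex.exp (- -((n - k : ℤ) : ℂ) * (θ : ℂ) * Complex.I) =
      Complex.exp ((n : ℂ) * (θ : ℂ) * Complex.I) *
        Complex.exp (-(k : ℂ) * (θ : ℂ) * Complex.I) := by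
    rw [← Complex.exp_add]
    congr 1
    push_cast
    ring
  rw [h]
  ring

theorem eq_zero_of_circlePairing_eq_zero (hnonneg : ∀ θ, 0 ≤ w θ)
    (hpos : ∀ θ ∈ Set.Ioo 0 Real.pi, 0 < w θ) {n : ℕ} {p : ℂ[X]} (hp : p.natDegree < n)
    (h : ∀ k < n, circlePairing w hw (k : ℤ) p = 0) : p = 0 := by
  have hpi := Real.pi_pos
  have hcont : Continuous fun θ : ℝ => p.eval (Complex.exp ((θ : ℂ) * Complex.I)) := by
    have := p.continuous
    fun_prop
  have hint : IntervalIntegrable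
      (fun θ : ℝ => ‖p.eval (Complex.exp ((θ : ℂ) * Complex.I))‖ ^ 2 * w θ) volume
      0 (2 * Real.pi) := hw.continuousOn_mul (hcont.norm.pow 2).continuousOn
  have hzero : ∫ θ in (0 : ℝ)..(2 * Real.pi),
      ‖p.eval (Complex.exp ((θ : ℂ) * Complex.I))‖ ^ 2 * w θ = 0 := by
    have hsum : ∑ k ∈ Finset.range n,
        (starRingEnd ℂ) (p.coeff k) * circlePairing w hw (k : ℤ) p = 0 :=
      Finset.sum_eq_zero fun k hk => by rw [h k (Finset.mem_range.1 hk), mul_zero]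
    have hswap : ∑ k ∈ Finset.range n,
        (starRingEnd ℂ) (p.coeff k) * circlePairing w hw (k : ℤ) p =
        ∫ θ in (0 : ℝ)..(2 * Real.pi),
          ((‖p.eval (Complex.exp ((θ : ℂ) * Complex.I))‖ ^ 2 * w θ : ℝ) : ℂ) := by
      simp_rw [circlePairing_apply, ← intervalIntegral.integral_const_mul]
      rw [← intervalIntegral.integral_finsetSum fun (k : ℕ) _ =>
        (intervalIntegrable_eval_circle hw p k).const_mul _]
      congr 1 with θ
      have hconj : (starRingEnd ℂ) (p.eval (Complex.exp ((θ : ℂ) * Complex.I))) =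
          ∑ k ∈ Finset.range n, (starRingEnd ℂ) (p.coeff k) *
            Complex.exp (-(k : ℂ) * (θ : ℂ) * Complex.I) := by
        rw [eval_eq_sum_range' hp, map_sum]
        refine Finset.sum_congr rfl fun k _ => ?_
        rw [map_mul, ← Complex.exp_nat_mul, ← conj_exp_mul_I θ k (by simp), mul_assoc]
      push_cast
      rw [← Complex.mul_conj', hconj, Finset.mul_sum, Finset.sum_mul]
      refine Finset.sum_congr rfl fun k _ => ?_
      ring
    rw [hsum, intervalIntegral.integral_ofReal] at hswap
    exact_mod_cast hswap.symm
  rw [intervalIntegral.integral_eq_zero_iff_of_le_of_nonneg_ae (by positivity)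
    (Filter.Eventually.of_forall fun θ => mul_nonneg (by positivity) (hnonneg θ)) hint] at hzero
  have hsub : Set.Ioo 0 Real.pi ⊆ Set.Ioc 0 (2 * Real.pi) :=
    fun θ hθ => ⟨hθ.1, by linarith [hθ.2]⟩
  have hae : (fun θ : ℝ => p.eval (Complex.exp ((θ : ℂ) * Complex.I)))
      =ᵐ[volume.restrict (Set.Ioo 0 Real.pi)] fun _ => 0 := by
    filter_upwards [ae_restrict_of_ae_restrict_of_subset hsub hzero,
      ae_restrict_mem measurableSet_Ioo] with θ hθ hmem
    simpa [(hpos θ hmem).ne'] using hθ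
  have heq := Measure.eqOn_open_of_ae_eq hae isOpen_Ioo hcont.continuousOn continuousOn_const
  refine eq_zero_of_infinite_isRoot p ?_
  have hinj : Set.InjOn (fun θ : ℝ => Complex.exp ((θ : ℂ) * Complex.I))
      (Set.Ioo 0 Real.pi) := by
    intro x hx y hy hxy
    have hre := congrArg Complex.re hxy
    simp only [Complex.exp_ofReal_mul_I_re] at hre
    exact Real.injOn_cos ⟨hx.1.le, hx.2.le⟩ ⟨hy.1.le, hy.2.le⟩ hre
  refine ((Set.Ioo_infinite hpi).image hinj).mono ?_
  rintro _ ⟨θ, hθ, rfl⟩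
  exact heq hθ

end circlePairing

theorem circlePairing_jacobi_pearson {lam β : ℝ} (hlam : -1 / 2 < lam) (hβ : -1 / 2 < β) (η : ℝ)
    {d : ℂ} (hd : d = (lam : ℂ) + (β : ℂ) + (η : ℂ) * Complex.I) (k : ℤ) (p : ℂ[X]) :
    circlePairing (circleJacobiWeight lam β η)
      (intervalIntegrable_circleJacobiWeight hlam hβ η) (k + 1)
      ((X ^ 2 - 1) * (X * derivative p) +
        (C (1 + d - k) * X ^ 2 + C (2 * ((lam : ℂ) - β)) * X +
          C (1 + (starRingEnd ℂ) d + k)) * p) = 0 := by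
  set q := (X ^ 2 - 1) * (X * derivative p) +
        (C (1 + d - k) * X ^ 2 + C (2 * ((lam : ℂ) - β)) * X +
          C (1 + (starRingEnd ℂ) d + k)) * p with hq
  have hint := intervalIntegrable_eval_circle
    (intervalIntegrable_circleJacobiWeight hlam hβ η) q (k + 1)
  have hz' : ∀ θ : ℝ, HasDerivAt (fun θ : ℝ => Complex.exp ((θ : ℂ) * Complex.I))
      (Complex.exp ((θ : ℂ) * Complex.I) * (1 * Complex.I)) θ := fun θ =>
    ((hasDerivAt_id (θ : ℂ)).mul_const Complex.I).cexp.comp_ofReal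
  have he' : ∀ θ : ℝ, HasDerivAt (fun θ : ℝ => Complex.exp (-(k : ℂ) * (θ : ℂ) * Complex.I))
      (Complex.exp (-(k : ℂ) * (θ : ℂ) * Complex.I) * (-(k : ℂ) * 1 * Complex.I)) θ := fun θ =>
    (((hasDerivAt_id (θ : ℂ)).const_mul (-(k : ℂ))).mul_const Complex.I).cexp.comp_ofReal
  have hp' : ∀ θ : ℝ, HasDerivAt (fun θ : ℝ => p.eval (Complex.exp ((θ : ℂ) * Complex.I)))
      ((derivative p).eval (Complex.exp ((θ : ℂ) * Complex.I)) *
        (Complex.exp ((θ : ℂ) * Complex.I) * (1 * Complex.I))) θ := fun θ =>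
    (p.hasDerivAt _).comp θ (hz' θ)
  have hcont : Continuous fun θ : ℝ =>
      ((Real.sin θ * circleJacobiWeight lam β η θ : ℝ) : ℂ) *
        (p.eval (Complex.exp ((θ : ℂ) * Complex.I)) *
          Complex.exp (-(k : ℂ) * (θ : ℂ) * Complex.I)) := by
    refine (Complex.continuous_ofReal.comp
      (continuous_sin_mul_circleJacobiWeight hlam hβ η)).mul ?_
    have := p.continuous
    fun_prop
  have hderiv : ∀ θ ∈ Set.Ioo 0 (2 * Real.pi) \ {Real.pi}, HasDerivAt (fun θ : ℝ =>
      ((Real.sin θ * circleJacobiWeight lam β η θ : ℝ) : ℂ) *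
        (p.eval (Complex.exp ((θ : ℂ) * Complex.I)) *
          Complex.exp (-(k : ℂ) * (θ : ℂ) * Complex.I)))
      (1 / 2 * (q.eval (Complex.exp ((θ : ℂ) * Complex.I)) *
        Complex.exp (-((k + 1 : ℤ) : ℂ) * (θ : ℂ) * Complex.I) *
          (circleJacobiWeight lam β η θ : ℂ))) θ := by
    rintro θ ⟨⟨h0, h2⟩, hne⟩
    have hs : Real.sin (θ / 2) ≠ 0 :=
      (Real.sin_pos_of_pos_of_lt_pi (by linarith) (by linarith)).ne'
    have hc : Real.cos (θ / 2) ≠ 0 := by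
      rcases lt_or_gt_of_ne (show θ ≠ Real.pi from hne) with h | h
      · exact (Real.cos_pos_of_mem_Ioo ⟨by linarith, by linarith⟩).ne'
      · exact (Real.cos_neg_of_pi_div_two_lt_of_lt (by linarith) (by linarith)).ne
    refine ((hasDerivAt_sin_mul_circleJacobiWeight lam β η hs hc).ofReal_comp.mul
      ((hp' θ).mul (he' θ))).congr_deriv ?_
    have hexp : Complex.exp (-((k + 1 : ℤ) : ℂ) * (θ : ℂ) * Complex.I) =
        Complex.exp (-(k : ℂ) * (θ : ℂ) * Complex.I) *
          (Complex.exp ((θ : ℂ) * Complex.I))⁻¹ := by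
      rw [← Complex.exp_neg, ← Complex.exp_add]
      congr 1
      push_cast
      ring
    have hsin : (Real.sin θ : ℂ) = ((Complex.exp ((θ : ℂ) * Complex.I))⁻¹ -
        Complex.exp ((θ : ℂ) * Complex.I)) * Complex.I / 2 := by
      rw [Complex.ofReal_sin, Complex.sin, ← Complex.exp_neg, neg_mul]
    have hcos : (Real.cos θ : ℂ) = (Complex.exp ((θ : ℂ) * Complex.I) +
        (Complex.exp ((θ : ℂ) * Complex.I))⁻¹) / 2 := by
      rw [Complex.ofReal_cos, Complex.cos, ← Complex.exp_neg, neg_mul]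
    have hconj : (starRingEnd ℂ) d = (lam : ℂ) + (β : ℂ) - (η : ℂ) * Complex.I := by
      rw [hd]
      simp [sub_eq_add_neg]
    have hz0 : Complex.exp ((θ : ℂ) * Complex.I) ≠ 0 := Complex.exp_ne_zero _
    rw [hexp, hq, hconj, hd]
    simp only [eval_add, eval_mul, eval_sub, eval_pow, eval_X, eval_C, eval_one]
    push_cast [hsin, hcos]
    simp only [Pi.mul_apply]
    field_simp
    ring_nf
    simp only [Complex.I_sq]
    ring
  have hftc := integral_eq_of_hasDerivAt_off_countable_of_le _ _ (by positivity)
    (Set.countable_singleton Real.pi) hcont.continuousOn hderiv (hint.const_mul (1 / 2))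
  rw [intervalIntegral.integral_const_mul] at hftc
  rw [circlePairing_apply]
  simpa using hftc

theorem coeff_X_mul_derivative (p : ℂ[X]) (m : ℕ) :
    (X * derivative p).coeff m = m * p.coeff m := by
  rcases m with _ | m
  · simp
  · rw [coeff_X_mul, coeff_derivative]
    push_cast
    ring

section PairingAlgebra

variable {L : ℤ → ℂ[X] →ₗ[ℂ] ℂ}

theorem pairing_C_mul (k : ℤ) (c : ℂ) (p : ℂ[X]) : L k (C c * p) = c * L k p := by
  rw [← smul_eq_C_mul, map_smul, smul_eq_mul]

theorem eq_zero_of_coeff_zero_of_pairing (hX : ∀ k p, L k (X * p) = L (k - 1) p)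
    (hdef : ∀ (n : ℕ) (p : ℂ[X]), p.natDegree < n → (∀ k < n, L (k : ℤ) p = 0) → p = 0)
    {n : ℕ} (hn : 1 ≤ n) {p : ℂ[X]} (hp : p.natDegree ≤ n) (h0 : p.coeff 0 = 0)
    (h : ∀ k < n, L ((k : ℤ) + 1) p = 0) : p = 0 := by
  have hdiv : X * p.divX = p := by
    have h := X_mul_divX_add p
    rwa [h0, C_0, add_zero] at h
  have hzero : p.divX = 0 := by
    refine hdef n _ ?_ fun k hk => ?_
    · rw [natDegree_divX_eq_natDegree_tsub_one]
      omega
    · have hk := h k hk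
      rwa [← hdiv, hX, add_sub_cancel_right] at hk
  rw [← hdiv, hzero, mul_zero]

theorem pairing_reflect_eq_zero
    (hrev : ∀ (k : ℤ) (n : ℕ) (p : ℂ[X]), p.natDegree ≤ n →
      L k (reflect n (p.map (starRingEnd ℂ))) = (starRingEnd ℂ) (L (n - k) p))
    {n : ℕ} {p : ℂ[X]} (hp : p.natDegree = n) (horth : ∀ k < n, L (k : ℤ) p = 0)
    {k : ℤ} (hk1 : 1 ≤ k) (hkn : k ≤ n) :
    L k (reflect n (p.map (starRingEnd ℂ))) = 0 := by
  rw [hrev k n p hp.le]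
  obtain ⟨m, hm⟩ := Int.eq_ofNat_of_zero_le (sub_nonneg.2 hkn)
  rw [hm, horth m (by omega), map_zero]

theorem szego_recurrence (hX : ∀ k p, L k (X * p) = L (k - 1) p)
    (hrev : ∀ (k : ℤ) (n : ℕ) (p : ℂ[X]), p.natDegree ≤ n →
      L k (reflect n (p.map (starRingEnd ℂ))) = (starRingEnd ℂ) (L (n - k) p))
    (hdef : ∀ (n : ℕ) (p : ℂ[X]), p.natDegree < n → (∀ k < n, L (k : ℤ) p = 0) → p = 0)
    {n : ℕ} (hn : 1 ≤ n) {p q : ℂ[X]} (hp : p.Monic) (hpn : p.natDegree = n)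
    (hporth : ∀ k < n, L (k : ℤ) p = 0) (hq : q.Monic) (hqn : q.natDegree = n + 1)
    (hqorth : ∀ k < n + 1, L (k : ℤ) q = 0) :
    q = X * p + C (q.coeff 0) * reflect n (p.map (starRingEnd ℂ)) := by
  have hpc : p.coeff n = 1 := hpn ▸ hp.coeff_natDegree
  have hqc : q.coeff (n + 1) = 1 := hqn ▸ hq.coeff_natDegree
  refine sub_eq_zero.1 (eq_zero_of_coeff_zero_of_pairing hX hdef hn ?_ ?_ fun k hk => ?_)
  · rw [natDegree_le_iff_coeff_eq_zero]
    intro N hN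
    obtain ⟨m, rfl⟩ : ∃ m, N = m + 1 := ⟨N - 1, by omega⟩
    have hr : (reflect n (p.map (starRingEnd ℂ))).coeff (m + 1) = 0 := by
      rw [coeff_reflect, revAt_eq_self_of_lt (by omega), coeff_map,
        coeff_eq_zero_of_natDegree_lt (by omega), map_zero]
    rw [coeff_sub, coeff_add, coeff_X_mul, coeff_C_mul, hr]
    rcases eq_or_ne m n with rfl | hm
    · simp [hpc, hqc]
    · rw [coeff_eq_zero_of_natDegree_lt (show q.natDegree < m + 1 by omega),
        coeff_eq_zero_of_natDegree_lt (show p.natDegree < m by omega)]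
      simp
  · simp [coeff_reflect, hpc]
  · rw [map_sub, map_add, hX, pairing_C_mul, add_sub_cancel_right, hporth k hk,
      pairing_reflect_eq_zero hrev hpn hporth (by omega) (by omega)]
    have h := hqorth (k + 1) (by omega)
    push_cast at h
    simp [h]

theorem structure_relation (hX : ∀ k p, L k (X * p) = L (k - 1) p)
    (hrev : ∀ (k : ℤ) (n : ℕ) (p : ℂ[X]), p.natDegree ≤ n →
      L k (reflect n (p.map (starRingEnd ℂ))) = (starRingEnd ℂ) (L (n - k) p))
    (hdef : ∀ (n : ℕ) (p : ℂ[X]), p.natDegree < n → (∀ k < n, L (k : ℤ) p = 0) → p = 0)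
    {d e τ : ℂ} (hpearson : ∀ (k : ℤ) (p : ℂ[X]), L (k + 1) ((X ^ 2 - 1) * (X * derivative p) +
      (C (1 + d - k) * X ^ 2 + C τ * X + C (1 + e + k)) * p) = 0)
    {n : ℕ} (hn : 2 ≤ n) {p q : ℂ[X]} (hp : p.Monic) (hpn : p.natDegree = n)
    (hporth : ∀ k < n, L (k : ℤ) p = 0) (hq : q.Monic) (hqn : q.natDegree = n + 1)
    (hqorth : ∀ k < n + 1, L (k : ℤ) q = 0) :
    (X ^ 2 - 1) * (X * derivative p) =
      (C (n : ℂ) * X ^ 2 -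
          C (q.coeff n + (d + n) * q.coeff 0 * (starRingEnd ℂ) (p.coeff 0)) * X -
          C (e + n)) * p +
        (C ((d + n + 1) * q.coeff 0) * X + C ((e + n) * p.coeff 0)) *
          reflect n (p.map (starRingEnd ℂ)) := by
  have hszego := szego_recurrence hX hrev hdef (by omega) hp hpn hporth hq hqn hqorth
  have hpc : p.coeff n = 1 := hpn ▸ hp.coeff_natDegree
  set r := reflect n (p.map (starRingEnd ℂ)) with hr
  set c := q.coeff n + (d + n) * q.coeff 0 * (starRingEnd ℂ) (p.coeff 0) with hc
  have hrn : r.coeff n = (starRingEnd ℂ) (p.coeff 0) := by simp [hr, coeff_reflect]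
  have hr0 : r.coeff 0 = 1 := by simp [hr, coeff_reflect, hpc]
  have hrlt : ∀ m, n < m → r.coeff m = 0 := fun m hm => by
    rw [hr, coeff_reflect, revAt_eq_self_of_lt hm, coeff_map,
      coeff_eq_zero_of_natDegree_lt (by omega), map_zero]
  have hplt : ∀ m, n < m → p.coeff m = 0 := fun m hm =>
    coeff_eq_zero_of_natDegree_lt (by omega)
  refine sub_eq_zero.1
    (eq_zero_of_coeff_zero_of_pairing (n := n) hX hdef (by omega) ?_ ?_ fun k hk => ?_)
  · rw [natDegree_le_iff_coeff_eq_zero]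
    intro N hN
    obtain ⟨m, rfl⟩ : ∃ m, N = m + 2 := ⟨N - 2, by omega⟩
    have hexpand : (X ^ 2 - 1) * (X * derivative p) -
        ((C (n : ℂ) * X ^ 2 - C c * X - C (e + n)) * p +
          (C ((d + n + 1) * q.coeff 0) * X + C ((e + n) * p.coeff 0)) * r) =
        (X ^ 2 * (X * derivative p) - X * derivative p) -
        ((C (n : ℂ) * (X ^ 2 * p) - C c * (X * p) - C (e + n) * p) +
          (C ((d + n + 1) * q.coeff 0) * (X * r) + C ((e + n) * p.coeff 0) * r)) := by
      ring
    rw [hexpand]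
    simp only [coeff_sub, coeff_add, coeff_C_mul, coeff_X_pow_mul, coeff_X_mul_derivative]
    simp only [coeff_X_mul]
    rw [hplt (m + 2) (by omega), hrlt (m + 2) (by omega)]
    rcases lt_trichotomy m n with hm | rfl | hm
    · obtain rfl : n = m + 1 := by omega
      have hqc := congrArg (fun f => coeff f (m + 1)) hszego
      simp only [coeff_add, coeff_X_mul, coeff_C_mul] at hqc
      rw [hrn] at hqc ⊢
      rw [hpc, hc, hqc]
      push_cast
      ring
    · rw [hplt (m + 1) (by omega), hrlt (m + 1) (by omega)]
      ring
    · rw [hplt (m + 1) (by omega), hrlt (m + 1) (by omega), hplt m hm]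
      ring
  · simp only [coeff_zero_eq_eval_zero] at hr0 ⊢
    simp [hr0]
    ring
  · have hexpand : (X ^ 2 - 1) * (X * derivative p) -
        ((C (n : ℂ) * X ^ 2 - C c * X - C (e + n)) * p +
          (C ((d + n + 1) * q.coeff 0) * X + C ((e + n) * p.coeff 0)) * r) =
        ((X ^ 2 - 1) * (X * derivative p) +
          (C (1 + d - (k : ℤ)) * X ^ 2 + C τ * X + C (1 + e + (k : ℤ))) * p) -
        (C (1 + d - (k : ℤ) + n) * (X * (X * p)) + C (τ - c) * (X * p) +
          C (1 + ((k : ℤ) : ℂ) - n) * p) -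
        (C ((d + n + 1) * q.coeff 0) * (X * r) + C ((e + n) * p.coeff 0) * r) := by
      simp only [C_add, C_sub, C_1]
      ring
    have hrk : L ((k : ℤ) + 1) r = 0 :=
      pairing_reflect_eq_zero hrev hpn hporth (by omega) (by omega)
    have hpk : (1 + ((k : ℤ) : ℂ) - n) * L ((k : ℤ) + 1) p = 0 := by
      rcases eq_or_ne (k + 1) n with h | h
      · rw [← h]
        push_cast
        ring
      · have := hporth (k + 1) (by omega)
        push_cast at this
        rw [this, mul_zero]
    rw [hexpand, map_sub, map_sub, hpearson]
    simp only [LinearMap.map_add, pairing_C_mul, hX, hpk, hrk, add_sub_cancel_right, hporth k hk]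
    rcases k with _ | k
    · have h0 := hqorth 0 (by omega)
      rw [hszego, map_add, hX, pairing_C_mul] at h0
      push_cast at h0 ⊢
      linear_combination (-(1 + d + n)) * h0
    · have hk' := hporth k (by omega)
      have hrk' : L ((k : ℤ) + 1) r = 0 :=
        pairing_reflect_eq_zero hrev hpn hporth (by omega) (by omega)
      push_cast
      rw [add_sub_cancel_right, hk', hrk']
      ring

end PairingAlgebra

theorem reflect_X_mul_derivative {n : ℕ} {p : ℂ[X]} (hp : p.natDegree ≤ n) :
    reflect n (X * derivative p) = C (n : ℂ) * reflect n p - X * derivative (reflect n p) := by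
  ext m
  rw [coeff_reflect, coeff_X_mul_derivative, coeff_sub, coeff_C_mul, coeff_X_mul_derivative, coeff_reflect]
  rcases le_or_gt m n with hm | hm
  · rw [revAt_le hm, Nat.cast_sub hm]
    ring
  · rw [revAt_eq_self_of_lt hm, coeff_eq_zero_of_natDegree_lt (by omega)]
    ring

theorem reflected_structure_relation {n : ℕ} {p : ℂ[X]} (hp : p.natDegree ≤ n) {c e f g : ℂ}
    (h : (X ^ 2 - 1) * (X * derivative p) =
      (C (n : ℂ) * X ^ 2 - C c * X - C (e + n)) * p +
        (C f * X + C g) * reflect n (p.map (starRingEnd ℂ))) :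
    (1 - X ^ 2) * derivative (reflect n (p.map (starRingEnd ℂ))) =
      -(C ((starRingEnd ℂ) g) * X + C ((starRingEnd ℂ) f)) * p +
        (C ((starRingEnd ℂ) e) * X + C ((starRingEnd ℂ) c)) *
          reflect n (p.map (starRingEnd ℂ)) := by
  have hconj : ((p.map (starRingEnd ℂ)).map (starRingEnd ℂ)) = p := by
    ext
    simp
  have hpc : (p.map (starRingEnd ℂ)).natDegree ≤ n := natDegree_map_le.trans hp
  have hder : (X * derivative (p.map (starRingEnd ℂ))).natDegree ≤ n := by
    rw [natDegree_le_iff_coeff_eq_zero]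
    intro m hm
    rw [coeff_X_mul_derivative, coeff_eq_zero_of_natDegree_lt (by omega), mul_zero]
  have hmap := congrArg (fun s => reflect (2 + n) (s.map (starRingEnd ℂ))) h
  simp only [Polynomial.map_add, Polynomial.map_sub, Polynomial.map_mul, Polynomial.map_pow,
    map_X, map_C, Polynomial.map_one, ← reflect_map, hconj, ← derivative_map,
    map_add, Complex.conj_natCast] at hmap
  rw [reflect_mul _ _ (by compute_degree) hder, reflect_add,
    reflect_mul _ _ (by compute_degree) hpc,
    reflect_mul _ _ (by compute_degree!) (natDegree_reflect_le.trans (max_le le_rfl hp)),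
    reflect_X_mul_derivative hpc, reflect_reflect] at hmap
  have hX1 : reflect 2 (X : ℂ[X]) = X := by
    have := reflect_monomial (R := ℂ) 2 1
    rwa [pow_one, revAt_le (by norm_num), pow_one] at this
  have hX2 : reflect 2 (X ^ 2 : ℂ[X]) = 1 := by
    rw [reflect_monomial, revAt_le le_rfl, Nat.sub_self, pow_zero]
  simp only [reflect_sub, reflect_add, reflect_C_mul, reflect_C, reflect_one, hX1, hX2] at hmap
  refine mul_left_cancel₀ (X_ne_zero (R := ℂ)) ?_
  linear_combination -hmap

theorem stmt_18
    (lam β η : ℝ) (hlam : -1/2 < lam) (hβ : -1/2 < β)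
    (d : ℂ) (hd : d = (lam : ℂ) + (β : ℂ) + (η : ℂ) * Complex.I)
    (w : ℝ → ℝ)
    (hw : ∀ θ : ℝ, w θ = Real.exp (-η * θ) * (Real.sin (θ/2)^2) ^ lam * (Real.cos (θ/2)^2) ^ β)
    (Φ : ℕ → Polynomial ℂ)
    (hmonic : ∀ n, (Φ n).Monic)
    (hdeg : ∀ n, (Φ n).natDegree = n)
    (horth : ∀ n, ∀ k < n,
      ∫ θ in (0:ℝ)..(2*Real.pi),
        (Φ n).eval (Complex.exp ((θ:ℂ) * Complex.I)) *
          Complex.exp (-(k : ℂ) * (θ:ℂ) * Complex.I) * (w θ : ℂ) = 0)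
    (α : ℕ → ℂ)
    (hα : ∀ m, α m = -(starRingEnd ℂ) ((Φ (m+1)).coeff 0))
    (ℓ : ℕ → ℕ → ℂ)
    (hℓ : ∀ n k, ℓ n k = (Φ n).coeff k)
    (Φs : ℕ → Polynomial ℂ)
    (hΦs : ∀ n, Φs n = ((Φ n).map (starRingEnd ℂ)).reverse)
    (n : ℕ) (hn : 3 ≤ n) :
    X * (X^2 - 1) * derivative (Φ n)
        = (C (n:ℂ) * X^2 - C (ℓ (n+1) n + (d + (n:ℂ)) * (starRingEnd ℂ) (α n) * α (n-1)) * X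
            - C ((starRingEnd ℂ) (d) + (n:ℂ))) * Φ n
          - (C ((d + (n:ℂ) + 1) * (starRingEnd ℂ) (α n)) * X
              + C (((starRingEnd ℂ) (d) + (n:ℂ)) * (starRingEnd ℂ) (α (n-1)))) * Φs n
    ∧ (1 - X^2) * derivative (Φs n)
        = (C ((d + (n:ℂ)) * α (n-1)) * X + C (((starRingEnd ℂ) (d) + (n:ℂ) + 1) * α n)) * Φ n
          + (C d * X + C ((starRingEnd ℂ) (ℓ (n+1) n) + ((starRingEnd ℂ) (d) + (n:ℂ)) * α n * (starRingEnd ℂ) (α (n-1)))) * Φs n := by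
  obtain rfl : w = circleJacobiWeight lam β η := funext hw
  have hint := intervalIntegrable_circleJacobiWeight hlam hβ η
  have horth' : ∀ m : ℕ, ∀ k < m, circlePairing _ hint (k : ℤ) (Φ m) = 0 := fun m k hk => by
    rw [circlePairing_apply]
    exact_mod_cast horth m k hk
  have hrel := structure_relation (L := circlePairing _ hint) (circlePairing_X_mul hint)
    (fun k m p hp => circlePairing_reflect hint k hp)
    (fun m p hp h => eq_zero_of_circlePairing_eq_zero hint (circleJacobiWeight_nonneg lam β η)
      (fun θ hθ => circleJacobiWeight_pos lam β η hθ) hp h)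
    (circlePairing_jacobi_pearson hlam hβ η hd) (by omega : 2 ≤ n) (hmonic n) (hdeg n)
    (horth' n) (hmonic (n + 1)) (hdeg (n + 1)) (horth' (n + 1))
  have hrel' := reflected_structure_relation (hdeg n).le hrel
  have hΦsn : Φs n = reflect n ((Φ n).map (starRingEnd ℂ)) := by
    rw [hΦs, reverse, natDegree_map, hdeg]
  have hαn : (Φ (n + 1)).coeff 0 = -(starRingEnd ℂ) (α n) := by simp [hα]
  have hαn' : (Φ n).coeff 0 = -(starRingEnd ℂ) (α (n - 1)) := by
    rw [hα, Nat.sub_add_cancel (by omega)]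
    simp
  rw [← hΦsn, ← hℓ (n + 1) n, hαn, hαn'] at hrel hrel'
  simp only [map_add, map_mul, map_neg, map_natCast, map_one, Complex.conj_conj] at hrel hrel' ⊢
  constructor
  · linear_combination hrel
  · linear_combination hrel'
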